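/- arXiv:0706.2320 — 9 statements merged into one kernel-verified Lean document; each statement's English description precedes it below -/
import Mathlib

section
/- Let p be a prime and let G be a group acting on a set X such that every element of G of order p fixes at most one point of X. Let S be a finite p-subgroup of G (a subgroup of p-power order) and let P ∈ X. If some nontrivial element of S fixes P, then every element of S fixes P, i.e. S is contained in the stabilizer of P. -/
theorem IsPGroup.exists_orderOf_pow_eq {G : Type*} [Group G] {p : ℕ} [Fact p.Prime]
    (hG : IsPGroup p G) {g : G} (hg : g ≠ 1) : ∃ k : ℕ, orderOf (g ^ k) = p := by
  obtain ⟨n, hn⟩ := IsPGroup.iff_orderOf.mp hG g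
  have hn0 : n ≠ 0 := by
    rintro rfl
    exact hg (orderOf_eq_one_iff.mp (by simpa using hn))
  have hpos : orderOf g ≠ 0 := hn ▸ pow_ne_zero n (Fact.out : p.Prime).ne_zero
  exact ⟨_, orderOf_pow_orderOf_div hpos (hn ▸ dvd_pow_self p hn0)⟩

theorem Commute.smul_eq_of_fixes_at_most_one {G X : Type*} [Group G] [MulAction G X] {g c : G}
    (hgc : Commute g c) (hg : ∀ x y : X, g • x = x → g • y = y → x = y)
    {P : X} (hP : g • P = P) : c • P = P :=
  hg _ _ (by rw [← mul_smul, hgc.eq, mul_smul, hP]) hP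

/-- Fixed-point propagation: if every element of order `p` fixes at most one point,
and some nontrivial element of a finite `p`-subgroup `S` fixes `P`, then all of `S`
fixes `P`. -/
theorem stmt_0 {G X : Type*} [Group G] [MulAction G X] {p : ℕ} (hp : p.Prime)
    (hstar : ∀ g : G, orderOf g = p → ∀ x y : X, g • x = x → g • y = y → x = y)
    (S : Subgroup G) (hS : ∃ n : ℕ, Nat.card S = p ^ n)
    (P : X) (h : ∃ s ∈ S, s ≠ 1 ∧ s • P = P) :
    ∀ s ∈ S, s • P = P := by
  have : Fact p.Prime := ⟨hp⟩
  obtain ⟨n, hn⟩ := hS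
  obtain ⟨s, hs, hs1, hsP⟩ := h
  have hpS : IsPGroup p S := IsPGroup.of_card hn
  have : Finite S := Nat.finite_of_card_ne_zero (hn ▸ pow_ne_zero n hp.ne_zero)
  have hs1' : (⟨s, hs⟩ : S) ≠ 1 := by simpa [Subtype.ext_iff] using hs1
  have : Nontrivial S := ⟨_, _, hs1'⟩
  have := hpS.center_nontrivial
  obtain ⟨w, hw⟩ := exists_ne (1 : Subgroup.center S)
  obtain ⟨l, hl⟩ := (hpS.to_subgroup _).exists_orderOf_pow_eq hw
  obtain ⟨k, hk⟩ := hpS.exists_orderOf_pow_eq hs1'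
  set z : Subgroup.center S := w ^ l
  have hz : ∀ t ∈ S, Commute ((z : S) : G) t := fun t ht =>
    (congrArg Subtype.val (Subgroup.mem_center_iff.mp z.2 ⟨t, ht⟩)).symm
  have hz_order : orderOf ((z : S) : G) = p := by
    rw [Subgroup.orderOf_coe, Subgroup.orderOf_coe, hl]
  have hsk_order : orderOf (s ^ k) = p := by
    rw [← hk, ← Subgroup.orderOf_coe]; rfl
  have hskP : s ^ k • P = P :=
    (MulAction.stabilizer G P).pow_mem (MulAction.mem_stabilizer_iff.mpr hsP) k
  have hzP : ((z : S) : G) • P = P :=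
    (hz _ (S.pow_mem hs k)).symm.smul_eq_of_fixes_at_most_one (hstar _ hsk_order) hskP
  exact fun t ht => (hz t ht).smul_eq_of_fixes_at_most_one (hstar _ hz_order) hzP
end

section
/- Let p be a prime and let G be a finite group acting on a set X such that every element of G of order p fixes at most one point of X. Let P ∈ X be a point such that p divides the order of the stabilizer G_P. Then every Sylow p-subgroup of G_P is a Sylow p-subgroup of G. -/
/-- If every element of order `p` fixes at most one point, then a finite `p`-subgroup having an
element of order `p` which fixes `P` is contained in the stabilizer of `P`. -/
theorem IsPGroup.le_stabilizer_of_orderOf_eq_prime {G X : Type*} [Group G] [MulAction G X] {p : ℕ}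
    [Fact p.Prime]
    (hstar : ∀ g : G, orderOf g = p → ∀ x y : X, g • x = x → g • y = y → x = y)
    {T : Subgroup G} [Finite T] (hT : IsPGroup p T) {P : X} {h : G} (hhT : h ∈ T)
    (hh : orderOf h = p) (hhP : h • P = P) : T ≤ MulAction.stabilizer G P := by
  have fixes_of_commute {a b : G} (hab : Commute a b) (ha : orderOf a = p) (haP : a • P = P) :
      b • P = P :=
    hstar a ha _ _ (by rw [← mul_smul, hab.eq, mul_smul, haP]) haP
  have : Nontrivial T := by
    refine ⟨⟨h, hhT⟩, 1, fun e ↦ (Fact.out : p.Prime).ne_one ?_⟩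
    rw [← hh, orderOf_eq_one_iff]
    exact congrArg Subtype.val e
  have hcenter : Nontrivial (Subgroup.center T) := hT.center_nontrivial
  have hdvd : p ∣ Nat.card (Subgroup.center T) := by
    obtain ⟨n, hn, hcard⟩ := (hT.to_subgroup (Subgroup.center T)).nontrivial_iff_card.mp hcenter
    exact hcard ▸ dvd_pow_self p hn.ne'
  obtain ⟨z, hz⟩ := exists_prime_orderOf_dvd_card' p hdvd
  have hzG : orderOf (z : G) = p := by simpa only [Subgroup.orderOf_coe] using hz
  have hcomm (t : G) (ht : t ∈ T) : Commute t (z : G) :=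
    congrArg Subtype.val (Subgroup.mem_center_iff.mp z.2 ⟨t, ht⟩)
  have hzP : (z : G) • P = P := fixes_of_commute (hcomm h hhT) hh hhP
  exact fun t ht ↦ fixes_of_commute (hcomm t ht).symm hzG hzP

/-- If every element of order `p` fixes at most one point and `p` divides the order
of the stabilizer of `P`, then every Sylow `p`-subgroup of the stabilizer of `P` is a
Sylow `p`-subgroup of `G`. -/
theorem stmt_1 {G X : Type*} [Group G] [Finite G] [MulAction G X] {p : ℕ} (hp : p.Prime)
    (hstar : ∀ g : G, orderOf g = p → ∀ x y : X, g • x = x → g • y = y → x = y)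
    (P : X) (hdvd : p ∣ Nat.card (MulAction.stabilizer G P)) :
    ∀ S : Sylow p (MulAction.stabilizer G P), ∃ T : Sylow p G,
      (S : Subgroup (MulAction.stabilizer G P)).map (MulAction.stabilizer G P).subtype
        = (T : Subgroup G) := by
  intro S
  have : Fact p.Prime := ⟨hp⟩
  obtain ⟨T, hT⟩ := S.exists_comap_subtype_eq
  obtain ⟨h, hh⟩ := exists_prime_orderOf_dvd_card' p (S.dvd_card_of_dvd_card hdvd)
  have hhG : orderOf (h : G) = p := by simpa only [Subgroup.orderOf_coe] using hh
  have hhT : ((h : MulAction.stabilizer G P) : G) ∈ (T : Subgroup G) :=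
    hT.ge h.2
  refine ⟨T, ?_⟩
  rw [← hT, Subgroup.map_comap_eq, Subgroup.range_subtype, inf_eq_right]
  exact T.isPGroup'.le_stabilizer_of_orderOf_eq_prime hstar hhT hhG h.1.2
end

section
/- Let p be a prime and let G be a finite group acting on a set X such that every element of G of order p fixes at most one point of X. Assume that some element of G of order p fixes a point of X. Then every element of G of order p fixes exactly one point of X. -/
theorem smul_eq_of_commute {G X : Type*} [Group G] [MulAction G X] {a b : G} {x : X}
    (hab : Commute a b) (huniq : ∀ y z : X, a • y = y → a • z = z → y = z)
    (ha : a • x = x) : b • x = x :=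
  huniq (b • x) x (by rw [smul_smul, hab.eq, mul_smul, ha]) ha

theorem IsPGroup.exists_mem_center_orderOf_eq {P : Type*} [Group P] [Finite P] [Nontrivial P]
    {p : ℕ} [Fact p.Prime] (hP : IsPGroup p P) :
    ∃ z ∈ Subgroup.center P, orderOf z = p := by
  have := hP.center_nontrivial
  have hdvd : p ∣ Nat.card (Subgroup.center P) :=
    (hP.to_subgroup _).card_eq_or_dvd.resolve_left Finite.one_lt_card.ne'
  obtain ⟨z, hz⟩ := exists_prime_orderOf_dvd_card' p hdvd
  exact ⟨z, z.2, by rw [Subgroup.orderOf_coe, hz]⟩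

/-- If elements of order `p` fix at most one point, then a `p`-subgroup fixes every point that is
fixed by one of its elements of order `p`. -/
theorem IsPGroup.smul_eq_of_orderOf_eq {G X : Type*} [Group G] [MulAction G X] {p : ℕ}
    [Fact p.Prime]
    (hstar : ∀ g : G, orderOf g = p → ∀ x y : X, g • x = x → g • y = y → x = y)
    {P : Subgroup G} [Finite P] (hP : IsPGroup p P) {g h : G} (hg : g ∈ P) (hh : h ∈ P)
    (hgp : orderOf g = p) {x : X} (hx : g • x = x) : h • x = x := by
  have : Nontrivial P := P.nontrivial_iff_exists_ne_one.2 ⟨g, hg, by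
    rintro rfl
    exact (Fact.out : p.Prime).ne_one (hgp.symm.trans orderOf_one)⟩
  obtain ⟨z, hzc, hzp⟩ := hP.exists_mem_center_orderOf_eq
  have hcomm (k : G) (hk : k ∈ P) : Commute k (z : G) :=
    congrArg Subtype.val (Subgroup.mem_center_iff.1 hzc ⟨k, hk⟩)
  have hzx : (z : G) • x = x := smul_eq_of_commute (hcomm g hg) (hstar g hgp) hx
  exact smul_eq_of_commute (hcomm h hh).symm
    (hstar z ((Subgroup.orderOf_coe z).trans hzp)) hzx


/-- If every element of order `p` fixes at most one point and some element of order `p`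
fixes a point, then every element of order `p` fixes exactly one point. -/
theorem stmt_2 {G X : Type*} [Group G] [Finite G] [MulAction G X] {p : ℕ} (hp : p.Prime)
    (hstar : ∀ g : G, orderOf g = p → ∀ x y : X, g • x = x → g • y = y → x = y)
    (hex : ∃ g : G, orderOf g = p ∧ ∃ x : X, g • x = x) :
    ∀ g : G, orderOf g = p → ∃! x : X, g • x = x := by
  have : Fact p.Prime := ⟨hp⟩
  have hpgroup (g : G) (hg : orderOf g = p) : IsPGroup p (Subgroup.zpowers g) :=
    IsPGroup.of_card (n := 1) (by rw [Nat.card_zpowers, hg, pow_one])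
  obtain ⟨g, hg, x, hx⟩ := hex
  intro h hh
  obtain ⟨P, hgP⟩ := (hpgroup g hg).exists_le_sylow
  obtain ⟨Q, hhQ⟩ := (hpgroup h hh).exists_le_sylow
  obtain ⟨k, rfl⟩ := MulAction.exists_smul_eq G P Q
  obtain ⟨q, hqP, hq⟩ := hhQ (Subgroup.mem_zpowers h)
  have hqx : q • x = x :=
    P.isPGroup'.smul_eq_of_orderOf_eq hstar (hgP (Subgroup.mem_zpowers g)) hqP hg hx
  have hqh : h = k * q * k⁻¹ := hq.symm
  have hhx : h • k • x = k • x := by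
    rw [hqh, smul_smul, inv_mul_cancel_right, mul_smul, hqx]
  exact ⟨k • x, hhx, fun y hy => hstar h hh y (k • x) hy hhx⟩
end

section
/- Let p be a prime and let G be a finite group acting on a set X such that every element of G of order p fixes at most one point of X. Let Ω = {x ∈ X : there exists g ∈ G of order p with g • x = x}. Then G acts transitively on Ω: for any x, y ∈ Ω there exists g ∈ G with g • x = y (and Ω is G-invariant). -/
/-- If `h` fixes no point other than `x`, then everything commuting with `h` fixes `x`. -/
theorem Commute.smul_eq_of_unique_fixed {G X : Type*} [Group G] [MulAction G X] {c h : G}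
    (hc : Commute c h) {x : X} (hx : h • x = x) (huniq : ∀ y : X, h • y = y → y = x) :
    c • x = x :=
  huniq _ (by rw [← mul_smul, ← hc.eq, mul_smul, hx])

/-- A nontrivial finite `p`-subgroup contains an element of order `p` commuting with all of its
elements. -/
theorem IsPGroup.exists_orderOf_eq_forall_commute {G : Type*} [Group G] {p : ℕ} [Fact p.Prime]
    {P : Subgroup G} [Finite P] [Nontrivial P] (hP : IsPGroup p P) :
    ∃ z : G, orderOf z = p ∧ ∀ h ∈ P, Commute z h := by
  have := hP.center_nontrivial
  obtain ⟨n, hn, hcard⟩ :=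
    (hP.to_subgroup (Subgroup.center P)).nontrivial_iff_card.mp inferInstance
  obtain ⟨z, hz⟩ := exists_prime_orderOf_dvd_card' (G := Subgroup.center P) p
    (hcard ▸ dvd_pow_self p hn.ne')
  refine ⟨z, by rw [Subgroup.orderOf_coe, Subgroup.orderOf_coe, hz], fun h hh ↦ ?_⟩
  exact congrArg Subtype.val (Subgroup.mem_center_iff.mp z.2 ⟨h, hh⟩).symm

/-- If elements of order `p` fix at most one point each, then those of a common finite
`p`-subgroup have no distinct fixed points. -/
theorem IsPGroup.fixed_point_eq {G X : Type*} [Group G] [MulAction G X] {p : ℕ} [Fact p.Prime]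
    (hstar : ∀ g : G, orderOf g = p → ∀ x y : X, g • x = x → g • y = y → x = y)
    {P : Subgroup G} [Finite P] (hP : IsPGroup p P) {h k : G} (hh : h ∈ P) (hk : k ∈ P)
    (ho : orderOf h = p) (ko : orderOf k = p) {x y : X} (hx : h • x = x) (hy : k • y = y) :
    x = y := by
  have : Nontrivial P := by
    refine (Subgroup.nontrivial_iff_exists_ne_one P).mpr ⟨h, hh, ?_⟩
    rintro rfl
    exact (Fact.out : p.Prime).ne_one (by simpa using ho.symm)
  obtain ⟨z, zo, hz⟩ := hP.exists_orderOf_eq_forall_commute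
  exact hstar z zo x y
    ((hz h hh).smul_eq_of_unique_fixed hx fun w hw ↦ hstar h ho w x hw hx)
    ((hz k hk).smul_eq_of_unique_fixed hy fun w hw ↦ hstar k ko w y hw hy)

theorem conj_smul_smul_eq {G X : Type*} [Group G] [MulAction G X] (g : G) {h : G} {x : X}
    (hx : h • x = x) : MulAut.conj g h • g • x = g • x := by
  simp [mul_smul, hx]


/-- If every element of order `p` fixes at most one point, then the set `Ω` of points
fixed by some element of order `p` is `G`-invariant and `G` acts transitively on it. -/
theorem stmt_3 {G X : Type*} [Group G] [Finite G] [MulAction G X] {p : ℕ} (hp : p.Prime)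
    (hstar : ∀ g : G, orderOf g = p → ∀ x y : X, g • x = x → g • y = y → x = y) :
    (∀ (g : G) (x : X), x ∈ {x : X | ∃ h : G, orderOf h = p ∧ h • x = x} →
        g • x ∈ {x : X | ∃ h : G, orderOf h = p ∧ h • x = x}) ∧
    (∀ x ∈ {x : X | ∃ h : G, orderOf h = p ∧ h • x = x},
      ∀ y ∈ {x : X | ∃ h : G, orderOf h = p ∧ h • x = x}, ∃ g : G, g • x = y) := by
  have : Fact p.Prime := ⟨hp⟩
  refine ⟨?_, ?_⟩
  · rintro g x ⟨h, ho, hx⟩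
    exact ⟨MulAut.conj g h, by rw [MulEquiv.orderOf_eq, ho], conj_smul_smul_eq g hx⟩
  · rintro x ⟨h, ho, hx⟩ y ⟨k, ko, hy⟩
    have exists_sylow (a : G) (ha : orderOf a = p) : ∃ P : Sylow p G, a ∈ P := by
      have hza : IsPGroup p (Subgroup.zpowers a) :=
        IsPGroup.of_card (n := 1) (by rw [Nat.card_zpowers, ha, pow_one])
      obtain ⟨P, hP⟩ := hza.exists_le_sylow
      exact ⟨P, hP (Subgroup.mem_zpowers a)⟩
    obtain ⟨P, hP⟩ := exists_sylow h ho
    obtain ⟨Q, hQ⟩ := exists_sylow k ko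
    obtain ⟨g, rfl⟩ := MulAction.exists_smul_eq G P Q
    exact ⟨g, (g • P).isPGroup'.fixed_point_eq hstar
      (Subgroup.smul_mem_pointwise_smul h (MulAut.conj g) P.toSubgroup hP) hQ
      ((MulEquiv.orderOf_eq (MulAut.conj g) h).trans ho) ko (conj_smul_smul_eq g hx) hy⟩
end

section
/- Let p be a prime, let q = p^e with e ≥ 1, and let g ≥ 2, γ ≥ 0, and m ≥ 2 be integers such that 2g − 2 = m·(2γ − 2) + (m − 1)·(q + 1) (an equality of integers) and p·g < (p − 1)·q. Then m = 2. -/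
/-- Numerical deduction on the kernel `M`: if `2g - 2 = m(2γ - 2) + (m-1)(q+1)` in ℤ
and `pg < (p-1)q` with `q = p^e`, `e ≥ 1`, `g ≥ 2`, `m ≥ 2`, then `m = 2`. -/
theorem stmt_5 (p q e g γ m : ℕ) (hp : p.Prime) (hq : q = p ^ e) (he : 1 ≤ e)
    (hg : 2 ≤ g) (hm : 2 ≤ m)
    (heq : (2 * g - 2 : ℤ) = (m : ℤ) * (2 * (γ : ℤ) - 2) + ((m : ℤ) - 1) * ((q : ℤ) + 1))
    (hineq : p * g < (p - 1) * q) :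
    m = 2 := by
  by_contra hne
  have hm3 : (3 : ℤ) ≤ m := by exact_mod_cast (show 3 ≤ m by omega)
  have hpq : p ≤ q := hq ▸ Nat.le_self_pow (by omega) p
  have hpq' : (p : ℤ) ≤ q := by exact_mod_cast hpq
  have hp1 : (1 : ℤ) ≤ p := by exact_mod_cast hp.one_le
  have hineq' : (p : ℤ) * g < (p - 1) * q := by
    have h : ((p * g : ℕ) : ℤ) < ((p - 1) * q : ℕ) := by exact_mod_cast hineq
    simpa [Nat.cast_sub hp.one_le] using h
  have hmγ : (0 : ℤ) ≤ m * γ := by positivity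
  have hgq : (q : ℤ) - 1 ≤ g := by
    have h : 0 ≤ ((m : ℤ) - 3) * (q - 1) := mul_nonneg (by linarith) (by linarith)
    linarith
  have h : (p : ℤ) * (q - 1) ≤ p * g := mul_le_mul_of_nonneg_left hgq (by linarith)
  linarith
end

section
/- Let p be a prime and let n ≥ 2 be a power of p. Let t be an odd positive integer and g an integer such that 2g = (n − 1)·(t·(n + 1)² − (n² + n + 1)) and p·g < (p − 1)·n³. Then t = 1 and 2g = n·(n − 1), i.e. g = n(n−1)/2. -/
/-- Numerical deduction in the `PSU(3,n)` case: under the stated genus relation and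
bound, `t = 1` and `2g = n(n-1)`. -/
theorem stmt_6 (p n t : ℕ) (g : ℤ) (hp : p.Prime) (hn : 2 ≤ n)
    (hpow : ∃ e : ℕ, n = p ^ e) (ht : 0 < t) (htodd : Odd t)
    (heq : 2 * g = ((n : ℤ) - 1) * ((t : ℤ) * ((n : ℤ) + 1) ^ 2 - ((n : ℤ) ^ 2 + n + 1)))
    (hineq : (p : ℤ) * g < ((p : ℤ) - 1) * (n : ℤ) ^ 3) :
    t = 1 ∧ 2 * g = (n : ℤ) * ((n : ℤ) - 1) := by
  have hn' : (2 : ℤ) ≤ n := by exact_mod_cast hn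
  have hp' : (0 : ℤ) < p := by exact_mod_cast hp.pos
  have ht1 : t = 1 := by
    by_contra hne
    have ht3 : (3 : ℤ) ≤ t := by
      obtain ⟨k, rfl⟩ := htodd
      omega
    have hg : (n : ℤ) ^ 3 ≤ g := by
      have hmul : (0 : ℤ) ≤ ((t : ℤ) - 3) * (((n : ℤ) - 1) * ((n : ℤ) + 1) ^ 2) :=
        mul_nonneg (by linarith) (mul_nonneg (by linarith) (sq_nonneg _))
      nlinarith
    have hpg : (p : ℤ) * (n : ℤ) ^ 3 ≤ p * g := mul_le_mul_of_nonneg_left hg hp'.le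
    have hn3 : (0 : ℤ) < (n : ℤ) ^ 3 := by positivity
    linarith
  subst ht1
  refine ⟨rfl, ?_⟩
  rw [heq]
  push_cast
  ring
end

section
/- Let n₀ = 2^k with k ≥ 1 and let n = 2·n₀². Let t be a positive divisor of n − 2n₀ + 1 and let g be an integer such that 2g = (t − 1)·(n² − 1) + 2·t·n₀·(n − 1) and 2g < n². Then t = 1 and g = n₀·(n − 1). -/
/-- Numerical deduction in case (B) of the Suzuki analysis: `t = 1` and
`g = n₀(n - 1)`. -/
theorem stmt_7 (k : ℕ) (hk : 1 ≤ k) (n₀ n t : ℕ) (hn₀ : n₀ = 2 ^ k)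
    (hn : n = 2 * n₀ ^ 2) (ht : 0 < t) (hdvd : t ∣ n - 2 * n₀ + 1) (g : ℤ)
    (heq : 2 * g = ((t : ℤ) - 1) * ((n : ℤ) ^ 2 - 1) + 2 * (t : ℤ) * (n₀ : ℤ) * ((n : ℤ) - 1))
    (hineq : 2 * g < (n : ℤ) ^ 2) :
    t = 1 ∧ g = (n₀ : ℤ) * ((n : ℤ) - 1) := by
  have h₀ : 1 ≤ n₀ := hn₀ ▸ Nat.one_le_two_pow
  have h₁ : 2 ≤ n := by nlinarith
  have h₀' : (1 : ℤ) ≤ n₀ := by exact_mod_cast h₀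
  have h₁' : (2 : ℤ) ≤ n := by exact_mod_cast h₁
  have ht1 : t = 1 := by
    by_contra hne
    have ht2 : (2 : ℤ) ≤ t := by exact_mod_cast (by omega : 2 ≤ t)
    have hsq : (n : ℤ) ^ 2 - 1 ≤ ((t : ℤ) - 1) * ((n : ℤ) ^ 2 - 1) :=
      le_mul_of_one_le_left (by nlinarith) (by linarith)
    have htn : (2 : ℤ) ≤ t * n₀ := by nlinarith
    have hlin : (2 : ℤ) ≤ t * n₀ * (n - 1) := by nlinarith
    linarith
  subst ht1
  refine ⟨rfl, ?_⟩
  push_cast at heq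
  linarith
end

section
/- Let n₀ = 3^k with k ≥ 1 and let n = 3·n₀². Let t be a positive divisor of n + 1 and let g ≥ 2 be an integer such that 2g = (n − 1)·((t − 1)·(n² + 1) − (t + 1)·n) and 3g < 2n³. Then t = 2, and consequently 2g = (n − 1)·(n² − 3n + 1). -/
/-- Numerical deduction in case (A) of the Ree analysis: `t = 2`, so
`2g = (n-1)(n² - 3n + 1)`. -/
theorem stmt_9 (k : ℕ) (hk : 1 ≤ k) (n₀ n t : ℕ) (hn₀ : n₀ = 3 ^ k)
    (hn : n = 3 * n₀ ^ 2) (ht : 0 < t) (hdvd : t ∣ n + 1) (g : ℤ) (hg : 2 ≤ g)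
    (heq : 2 * g = ((n : ℤ) - 1) * (((t : ℤ) - 1) * ((n : ℤ) ^ 2 + 1) - ((t : ℤ) + 1) * (n : ℤ)))
    (hineq : 3 * g < 2 * (n : ℤ) ^ 3) :
    t = 2 ∧ 2 * g = ((n : ℤ) - 1) * ((n : ℤ) ^ 2 - 3 * (n : ℤ) + 1) := by
  have hn27 : (27 : ℤ) ≤ n := by
    have h3 : 3 ≤ n₀ := by
      rw [hn₀]
      exact Nat.le_self_pow (by omega) 3
    have h : 27 ≤ n := by
      rw [hn]
      nlinarith
    exact_mod_cast h
  have ht2 : t = 2 := by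
    rcases lt_trichotomy t 2 with h | h | h
    · obtain rfl : t = 1 := by omega
      push_cast at heq
      nlinarith
    · exact h
    · exfalso
      have h3 : (3 : ℤ) ≤ t := by exact_mod_cast h
      have hcoeff : (0 : ℤ) ≤ ((n : ℤ) - 1) * ((n : ℤ) ^ 2 - n + 1) :=
        mul_nonneg (by linarith) (by nlinarith)
      have hmono := mul_nonneg hcoeff (sub_nonneg.2 h3)
      have hcube : 2 * (n : ℤ) ^ 3 ≤ 3 * ((n : ℤ) - 1) ^ 3 := by
        nlinarith [mul_nonneg (sq_nonneg (n : ℤ)) (sub_nonneg.2 hn27)]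
      linarith
  refine ⟨ht2, ?_⟩
  subst ht2
  rw [heq]
  push_cast
  ring
end

section
/- Let n₀ = 3^k with k ≥ 1 and let n = 3·n₀². Let t be a positive divisor of n − 3n₀ + 1 and let g ≥ 2 be an integer such that 2g = (n − 1)·(t·(n + 1)·(n + 3n₀ + 1) − (n² + n + 1)) and 3g < 2n³. Then t = 1 and 2g = 3·n₀·(n − 1)·(n + n₀ + 1). -/
/-- Numerical deduction in case (C) of the Ree analysis: `t = 1` and
`2g = 3n₀(n-1)(n + n₀ + 1)`. -/
theorem stmt_11 (k : ℕ) (hk : 1 ≤ k) (n₀ n t : ℕ) (hn₀ : n₀ = 3 ^ k)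
    (hn : n = 3 * n₀ ^ 2) (ht : 0 < t) (hdvd : t ∣ n - 3 * n₀ + 1) (g : ℤ) (hg : 2 ≤ g)
    (heq : 2 * g = ((n : ℤ) - 1) *
      ((t : ℤ) * ((n : ℤ) + 1) * ((n : ℤ) + 3 * (n₀ : ℤ) + 1) - ((n : ℤ) ^ 2 + n + 1)))
    (hineq : 3 * g < 2 * (n : ℤ) ^ 3) :
    t = 1 ∧ 2 * g = 3 * (n₀ : ℤ) * ((n : ℤ) - 1) * ((n : ℤ) + n₀ + 1) := by
  have h_three_le : 3 ≤ n₀ := hn₀ ▸ Nat.le_self_pow (by lia) 3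
  have h_odd : Odd n₀ := hn₀ ▸ Odd.pow (by decide)
  have h_n : (n : ℤ) = 3 * (n₀ : ℤ) ^ 2 := by exact_mod_cast hn
  have h_n_pos : (3 : ℤ) ≤ n := by
    have : 3 ≤ n := by nlinarith
    exact_mod_cast this
  have h_t_ne_two : t ≠ 2 := by
    rintro rfl
    have h_n_odd : Odd n := hn ▸ Odd.mul (by decide) h_odd.pow
    have h_le : 3 * n₀ ≤ n := by nlinarith
    obtain ⟨a, ha⟩ := h_odd
    obtain ⟨b, hb⟩ := h_n_odd
    lia
  have h_t_lt_three : t < 3 := by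
    by_contra! h
    have h_t : (3 : ℤ) ≤ t := by exact_mod_cast h
    have h_n₀ : (0 : ℤ) ≤ n₀ := by positivity
    have h_prod : 3 * ((n : ℤ) + 1) * (n + 1) ≤ t * (n + 1) * (n + 3 * n₀ + 1) := by
      gcongr
      linarith
    have h_genus : ((n : ℤ) - 1) * (3 * (n + 1) * (n + 1) - (n ^ 2 + n + 1)) ≤ 2 * g := by
      rw [heq]
      exact mul_le_mul_of_nonneg_left (by linarith) (by linarith)
    nlinarith [pow_pos (show (0 : ℤ) < n by linarith) 3]
  obtain rfl : t = 1 := by lia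
  refine ⟨rfl, ?_⟩
  rw [heq, h_n]
  push_cast
  ring
end
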